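/- Fix K > 0 and x ∈ (0,1), and let f₁(x,K) = P[|v₁| ≤ K, |v₂| ≤ K] for a centered Gaussian pair (v₁,v₂) with unit variances and covariance 1-2x. If α > -(ln 2 + H₂(x)) / ln f₁(x,K), then the probability that there exists a pair w¹, w² ∈ {-1,1}^N at Hamming distance ⌊Nx⌋ with |ξ^μ·w^a| ≤ K for all μ = 1,…,⌊αN⌋ and a = 1,2 tends to 0 as N → ∞, where the ξ^μ are independent random vectors with i.i.d. N(0,1/N) entries. -/

import Mathlib

open MeasureTheory ProbabilityTheory Real
open scoped NNReal

/-- The binary entropy function. -/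
noncomputable def H₂ (x : ℝ) : ℝ := -x * Real.log x - (1 - x) * Real.log (1 - x)

/-- `f₁(x,K) = P[|v₁| ≤ K, |v₂| ≤ K]` for a centered Gaussian pair with unit
variances and covariance `1 - 2x`, written as the integral of the bivariate
Gaussian density with correlation `q = 1 - 2x` over the square `[-K,K]²`. -/
noncomputable def f₁ (x K : ℝ) : ℝ :=
  ∫ v₁ in (-K)..K, ∫ v₂ in (-K)..K,
    (1 / (2 * π * Real.sqrt (1 - (1 - 2 * x) ^ 2))) *
      Real.exp (-(v₁ ^ 2 - 2 * (1 - 2 * x) * v₁ * v₂ + v₂ ^ 2) /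
        (2 * (1 - (1 - 2 * x) ^ 2)))

/-- The centered bivariate Gaussian density with unit variances and covariance `1 - 2 * y`. -/
noncomputable def pairDensity (y : ℝ) (v : ℝ × ℝ) : ℝ :=
  (1 / (2 * π * Real.sqrt (1 - (1 - 2 * y) ^ 2))) *
    Real.exp (-(v.1 ^ 2 - 2 * (1 - 2 * y) * v.1 * v.2 + v.2 ^ 2) /
      (2 * (1 - (1 - 2 * y) ^ 2)))

/-- The probability that `|A + B| ≤ K` and `|A - B| ≤ K` for independent centered Gaussians
`A`, `B` of variances `v` and `w`. -/
noncomputable def pairProb (v w : ℝ≥0) (K : ℝ) : ENNReal :=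
  ((gaussianReal 0 v).prod (gaussianReal 0 w)) {p | |p.1 + p.2| ≤ K ∧ |p.1 - p.2| ≤ K}

lemma one_sub_sq_pos {y : ℝ} (hy : y ∈ Set.Ioo (0 : ℝ) 1) : 0 < 1 - (1 - 2 * y) ^ 2 := by
  nlinarith [mul_pos hy.1 (sub_pos.2 hy.2)]

lemma pairDensity_pos {y : ℝ} (hy : y ∈ Set.Ioo (0 : ℝ) 1) (v : ℝ × ℝ) : 0 < pairDensity y v := by
  have := one_sub_sq_pos hy
  unfold pairDensity
  positivity

lemma continuous_pairDensity (y : ℝ) : Continuous (pairDensity y) := by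
  unfold pairDensity
  fun_prop

lemma f₁_eq_setIntegral (y : ℝ) {K : ℝ} (hK : 0 < K) :
    f₁ y K = ∫ v in Set.Icc (-K) K ×ˢ Set.Icc (-K) K, pairDensity y v := by
  have hi : IntegrableOn (pairDensity y) (Set.Icc (-K) K ×ˢ Set.Icc (-K) K)
      ((volume : Measure ℝ).prod volume) :=
    (continuous_pairDensity y).continuousOn.integrableOn_compact (isCompact_Icc.prod isCompact_Icc)
  have hle : -K ≤ K := by linarith
  rw [Measure.volume_eq_prod, setIntegral_prod _ hi]
  simp only [f₁, intervalIntegral.integral_of_le hle, integral_Icc_eq_integral_Ioc, pairDensity]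

lemma f₁_pos {y K : ℝ} (hy : y ∈ Set.Ioo (0 : ℝ) 1) (hK : 0 < K) : 0 < f₁ y K := by
  have hlt : -K < K := by linarith
  have hc := continuous_pairDensity y
  refine intervalIntegral.intervalIntegral_pos_of_pos
    (f := fun v₁ => ∫ v₂ in (-K)..K, pairDensity y (v₁, v₂)) ?_ (fun v₁ => ?_) hlt
  · apply Continuous.intervalIntegrable
    apply intervalIntegral.continuous_parametric_intervalIntegral_of_continuous'
    exact hc
  · refine intervalIntegral.intervalIntegral_pos_of_pos ?_ (fun v₂ => pairDensity_pos hy _) hlt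
    apply Continuous.intervalIntegrable
    fun_prop

lemma continuousOn_f₁ (K : ℝ) : ContinuousOn (fun y => f₁ y K) (Set.Ioo (0 : ℝ) 1) := by
  rw [continuousOn_iff_continuous_domRestrict]
  have : LocallyCompactSpace (Set.Ioo (0 : ℝ) 1) := isOpen_Ioo.locallyCompactSpace
  apply intervalIntegral.continuous_parametric_intervalIntegral_of_continuous'
    (f := fun (y : Set.Ioo (0 : ℝ) 1) v₁ => ∫ v₂ in (-K)..K, pairDensity y (v₁, v₂))
  apply intervalIntegral.continuous_parametric_intervalIntegral_of_continuous'
    (f := fun (p : Set.Ioo (0 : ℝ) 1 × ℝ) v₂ => pairDensity p.1 (p.2, v₂))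
  simp only [Function.uncurry_def, pairDensity]
  refine Continuous.mul (Continuous.div (by fun_prop) (by fun_prop) fun p => ?_)
    (Real.continuous_exp.comp (Continuous.div (by fun_prop) (by fun_prop) fun p => ?_))
  · have := one_sub_sq_pos p.1.1.2
    positivity
  · have := one_sub_sq_pos p.1.1.2
    positivity

/-- The linear map `(a, b) ↦ (a + b, a - b)`. -/
noncomputable def sumDiff : ℝ × ℝ →ₗ[ℝ] ℝ × ℝ :=
  (LinearMap.fst ℝ ℝ ℝ + LinearMap.snd ℝ ℝ ℝ).prod (LinearMap.fst ℝ ℝ ℝ - LinearMap.snd ℝ ℝ ℝ)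

lemma sumDiff_apply (p : ℝ × ℝ) : sumDiff p = (p.1 + p.2, p.1 - p.2) := rfl

lemma det_sumDiff : LinearMap.det sumDiff = -2 := by
  rw [← LinearMap.det_toMatrix (Module.Basis.finTwoProd ℝ), Matrix.det_fin_two]
  simp [LinearMap.toMatrix_apply, sumDiff_apply]
  norm_num

lemma lintegral_comp_sumDiff {F : ℝ × ℝ → ENNReal} (hF : Measurable F) :
    ∫⁻ p, F (sumDiff p) = ENNReal.ofReal 2⁻¹ * ∫⁻ p, F p := by
  have h := Measure.map_linearMap_addHaar_eq_smul_addHaar (volume : Measure (ℝ × ℝ))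
    (f := sumDiff) (by rw [det_sumDiff]; norm_num)
  rw [← lintegral_map hF (LinearMap.continuous_of_finiteDimensional _).measurable, h,
    lintegral_smul_measure, det_sumDiff]
  norm_num

lemma gaussianPDFReal_mul_gaussianPDFReal {y : ℝ} (hy : y ∈ Set.Ioo (0 : ℝ) 1) {v w : ℝ≥0}
    (hv : (v : ℝ) = 1 - y) (hw : (w : ℝ) = y) (p : ℝ × ℝ) :
    gaussianPDFReal 0 v p.1 * gaussianPDFReal 0 w p.2 = 2 * pairDensity y (sumDiff p) := by
  have h0 : 0 < y := hy.1
  have h1 : 0 < 1 - y := sub_pos.2 hy.2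
  have hq : 1 - (1 - 2 * y) ^ 2 = 2 ^ 2 * ((1 - y) * y) := by ring
  have hs : √(2 * π * (1 - y)) * √(2 * π * y) = 2 * π * √((1 - y) * y) := by
    rw [← Real.sqrt_mul (by positivity),
      show 2 * π * (1 - y) * (2 * π * y) = (2 * π) ^ 2 * ((1 - y) * y) by ring,
      Real.sqrt_mul (by positivity), Real.sqrt_sq (by positivity)]
  have hs' : √(2 ^ 2 * ((1 - y) * y)) = 2 * √((1 - y) * y) := by
    rw [Real.sqrt_mul (by positivity), Real.sqrt_sq (by positivity)]
  simp only [gaussianPDFReal, pairDensity, sumDiff_apply, hv, hw, hq]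
  rw [mul_mul_mul_comm, ← mul_inv, hs, ← Real.exp_add, hs', ← mul_assoc]
  congr 1
  · field_simp
  · congr 1
    field_simp
    ring

lemma pairProb_eq_f₁ {y K : ℝ} (hy : y ∈ Set.Ioo (0 : ℝ) 1) (hK : 0 < K) {v w : ℝ≥0}
    (hv : (v : ℝ) = 1 - y) (hw : (w : ℝ) = y) : pairProb v w K = ENNReal.ofReal (f₁ y K) := by
  have hv0 : v ≠ 0 := fun h => by simp [h] at hv; linarith [hy.2]
  have hw0 : w ≠ 0 := fun h => by simp [h] at hw; linarith [hy.1]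
  set S : Set (ℝ × ℝ) := Set.Icc (-K) K ×ˢ Set.Icc (-K) K
  have hS : MeasurableSet S := measurableSet_Icc.prod measurableSet_Icc
  have hm : Measurable (S.indicator fun v => ENNReal.ofReal (pairDensity y v)) :=
    ((continuous_pairDensity y).measurable.ennreal_ofReal).indicator hS
  have hpre : {p : ℝ × ℝ | |p.1 + p.2| ≤ K ∧ |p.1 - p.2| ≤ K} = sumDiff ⁻¹' S := by
    ext p
    simp [S, sumDiff_apply, abs_le, and_and_and_comm]
  have hL : Measurable sumDiff := (LinearMap.continuous_of_finiteDimensional _).measurable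
  rw [pairProb, gaussianReal_of_var_ne_zero _ hv0, gaussianReal_of_var_ne_zero _ hw0,
    prod_withDensity (by fun_prop) (by fun_prop), hpre, withDensity_apply _ (hL hS),
    ← lintegral_indicator (hL hS)]
  have hpt : ∀ p : ℝ × ℝ, (sumDiff ⁻¹' S).indicator
      (fun z => gaussianPDF 0 v z.1 * gaussianPDF 0 w z.2) p =
      2 * (S.indicator fun v => ENNReal.ofReal (pairDensity y v)) (sumDiff p) := by
    intro p
    by_cases hp : sumDiff p ∈ S
    · rw [Set.indicator_of_mem hp, Set.indicator_of_mem (show p ∈ sumDiff ⁻¹' S from hp),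
        gaussianPDF, gaussianPDF, ← ENNReal.ofReal_mul (gaussianPDFReal_nonneg _ _ _),
        gaussianPDFReal_mul_gaussianPDFReal hy hv hw, ENNReal.ofReal_mul (by norm_num)]
      norm_num
    · rw [Set.indicator_of_notMem hp,
        Set.indicator_of_notMem (show p ∉ sumDiff ⁻¹' S from hp), mul_zero]
  have hmL : Measurable fun p =>
      (S.indicator fun v => ENNReal.ofReal (pairDensity y v)) (sumDiff p) := hm.comp hL
  rw [lintegral_congr hpt, ← Measure.volume_eq_prod, lintegral_const_mul 2 hmL,
    lintegral_comp_sumDiff hm, ← mul_assoc, lintegral_indicator hS, f₁_eq_setIntegral y hK,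
    ofReal_integral_eq_lintegral_ofReal]
  · rw [ENNReal.ofReal_inv_of_pos (by norm_num), ENNReal.ofReal_ofNat,
      ENNReal.mul_inv_cancel (by norm_num) (by norm_num), one_mul]
  · exact (continuous_pairDensity y).continuousOn.integrableOn_compact
      (isCompact_Icc.prod isCompact_Icc)
  · exact ae_of_all _ fun p => (pairDensity_pos hy p).le

lemma f₁_lt_one {y K : ℝ} (hy : y ∈ Set.Ioo (0 : ℝ) 1) (hK : 0 < K) : f₁ y K < 1 := by
  have h1 : 0 < 1 - y := sub_pos.2 hy.2
  set v : ℝ≥0 := ⟨1 - y, h1.le⟩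
  set w : ℝ≥0 := ⟨y, hy.1.le⟩
  have hv0 : v ≠ 0 := fun h => h1.ne' (congrArg NNReal.toReal h)
  have hlt : pairProb v w K < 1 := by
    calc pairProb v w K
        ≤ ((gaussianReal 0 v).prod (gaussianReal 0 w)) ((Set.Ioi K)ᶜ ×ˢ Set.univ) := by
          refine measure_mono fun p hp => ⟨?_, trivial⟩
          have h₁ := (abs_le.1 hp.1).2
          have h₂ := (abs_le.1 hp.2).2
          simp only [Set.mem_compl_iff, Set.mem_Ioi, not_lt]
          linarith
      _ = 1 - gaussianReal 0 v (Set.Ioi K) := by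
          rw [Measure.prod_prod, measure_univ, mul_one, prob_compl_eq_one_sub measurableSet_Ioi]
      _ < 1 := by
          refine ENNReal.sub_lt_self (by simp) (by simp) fun h => ?_
          have := gaussianReal_absolutelyContinuous' 0 hv0 h
          simp at this
  rw [pairProb_eq_f₁ hy hK rfl rfl] at hlt
  exact ENNReal.ofReal_lt_one.1 hlt

lemma pi_prod_apply_forall {ι κ : Type*} [Fintype ι] [Fintype κ] (γ : Measure ℝ)
    [IsProbabilityMeasure γ] (S : Set (κ → ℝ)) :
    (Measure.pi fun _ : ι × κ => γ) {ξ | ∀ i, (fun k => ξ (i, k)) ∈ S} =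
      (Measure.pi fun _ : κ => γ) S ^ Fintype.card ι := by
  have h : (Measure.pi fun _ : ι × κ => γ) =
      (Measure.pi fun _ : ι => Measure.pi fun _ : κ => γ).map
        (MeasurableEquiv.curry ι κ ℝ).symm := by
    refine Measure.pi_eq fun s hs => ?_
    have hpre : (MeasurableEquiv.curry ι κ ℝ).symm ⁻¹' Set.univ.pi s =
        Set.univ.pi fun i => Set.univ.pi fun k => s (i, k) := by
      ext ξ
      simp [MeasurableEquiv.coe_curry_symm, Set.mem_pi]
    rw [MeasurableEquiv.map_apply, hpre, Measure.pi_pi, Fintype.prod_prod_type]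
    simp only [Measure.pi_pi]
  have hpre : (MeasurableEquiv.curry ι κ ℝ).symm ⁻¹' {ξ | ∀ i, (fun k => ξ (i, k)) ∈ S} =
      Set.univ.pi fun _ => S := by
    ext ξ
    simp [MeasurableEquiv.coe_curry_symm, Set.mem_pi]
  rw [h, MeasurableEquiv.map_apply, hpre, Measure.pi_pi, Finset.prod_const, Finset.card_univ]

section SignedSums

variable {ι : Type*} [Fintype ι] (v : ℝ≥0) {w : ι → ℝ}

lemma iIndepFun_mul_coord (w : ι → ℝ) :
    iIndepFun (fun i (ξ : ι → ℝ) => ξ i * w i) (Measure.pi fun _ : ι => gaussianReal 0 v) :=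
  iIndepFun_pi (X := fun i t => t * w i) fun _ => by fun_prop

lemma map_sum_mul_sign (hw : ∀ i, w i = 1 ∨ w i = -1) (s : Finset ι) :
    (Measure.pi fun _ : ι => gaussianReal 0 v).map (∑ i ∈ s, fun ξ : ι → ℝ => ξ i * w i) =
      gaussianReal 0 (s.card * v) := by
  classical
  induction s using Finset.induction_on with
  | empty =>
    have : (0 : (ι → ℝ) → ℝ) = fun _ => 0 := rfl
    simp [this, Measure.map_const]
  | insert a s ha ih =>
    have h1 : (Measure.pi fun _ : ι => gaussianReal 0 v).map (fun ξ : ι → ℝ => ξ a * w a) =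
        gaussianReal 0 v := by
      have h := (measurePreserving_eval (fun _ : ι => gaussianReal 0 v) a).map_eq
      have hc : (fun ξ : ι → ℝ => ξ a * w a) = (fun t => t * w a) ∘ Function.eval a := rfl
      rw [hc, ← Measure.map_map (by fun_prop) (by fun_prop), h, gaussianReal_map_mul_const]
      congr 1
      · simp
      · ext
        rcases hw a with h | h <;> simp [h]
    rw [Finset.sum_insert ha, add_comm, gaussianReal_add_gaussianReal_of_indepFun
      ((iIndepFun_mul_coord v w).indepFun_finsetSum_of_notMem (fun i => by fun_prop) ha) ih h1,
      Finset.card_insert_of_notMem ha]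
    congr 1
    · simp
    · push_cast
      ring

lemma pi_gaussianReal_pair {w₁ w₂ : ι → ℝ} (hw₁ : ∀ i, w₁ i = 1 ∨ w₁ i = -1)
    (hw₂ : ∀ i, w₂ i = 1 ∨ w₂ i = -1) (K : ℝ) :
    (Measure.pi fun _ : ι => gaussianReal 0 v)
        {ξ : ι → ℝ | |∑ i, ξ i * w₁ i| ≤ K ∧ |∑ i, ξ i * w₂ i| ≤ K} =
      pairProb ((Finset.univ.filter fun i => ¬ w₁ i ≠ w₂ i).card * v)
        ((Finset.univ.filter fun i => w₁ i ≠ w₂ i).card * v) K := by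
  classical
  set T := Finset.univ.filter fun i => w₁ i ≠ w₂ i
  set T' := Finset.univ.filter fun i => ¬ w₁ i ≠ w₂ i
  set X : ι → (ι → ℝ) → ℝ := fun i ξ => ξ i * w₁ i
  have hX : ∀ i, Measurable (X i) := fun i => by fun_prop
  have hmeas : ∀ s : Finset ι, Measurable (∑ i ∈ s, X i) := fun s => by fun_prop
  have hindep : IndepFun (∑ i ∈ T', X i) (∑ i ∈ T, X i)
      (Measure.pi fun _ : ι => gaussianReal 0 v) := by
    have h := (iIndepFun_mul_coord v w₁).indepFun_finset T' T
      (Finset.disjoint_filter_filter_not _ _ _).symm hX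
    have h' := h.comp (φ := fun f => ∑ i, f i) (ψ := fun f => ∑ i, f i)
      (by fun_prop) (by fun_prop)
    convert h' using 1
    · ext ξ
      simp [X, Finset.sum_attach T' fun i => ξ i * w₁ i]
    · ext ξ
      simp [X, Finset.sum_attach T fun i => ξ i * w₁ i]
  have hmap := hindep.map_prod_eq_prod_map_map (hmeas T').aemeasurable (hmeas T).aemeasurable
  rw [map_sum_mul_sign v hw₁, map_sum_mul_sign v hw₁] at hmap
  have hS : MeasurableSet {p : ℝ × ℝ | |p.1 + p.2| ≤ K ∧ |p.1 - p.2| ≤ K} := by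
    rw [Set.ofPred_and]
    exact (measurableSet_le (by fun_prop) measurable_const).inter
      (measurableSet_le (by fun_prop) measurable_const)
  rw [pairProb, ← hmap, Measure.map_apply ((hmeas T').prodMk (hmeas T)) hS]
  congr 1
  ext ξ
  have e₁ : ∑ i, ξ i * w₁ i = ∑ i ∈ T', ξ i * w₁ i + ∑ i ∈ T, ξ i * w₁ i := by
    rw [add_comm]
    exact (Finset.sum_filter_add_sum_filter_not _ _ _).symm
  have e₂ : ∑ i, ξ i * w₂ i = ∑ i ∈ T', ξ i * w₁ i - ∑ i ∈ T, ξ i * w₁ i := by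
    rw [← Finset.sum_filter_add_sum_filter_not Finset.univ (fun i => w₁ i ≠ w₂ i),
      add_comm, sub_eq_add_neg, ← Finset.sum_neg_distrib]
    congr 1
    · refine Finset.sum_congr rfl fun i hi => ?_
      rw [not_not.1 (Finset.mem_filter.1 hi).2]
    · refine Finset.sum_congr rfl fun i hi => ?_
      have hne := (Finset.mem_filter.1 hi).2
      rcases hw₁ i with h₁ | h₁ <;> rcases hw₂ i with h₂ | h₂ <;> simp_all
  simp only [Set.mem_ofPred_eq, Set.mem_preimage, Finset.sum_apply, X, e₁, e₂]

end SignedSums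

/-- The sign vector which is `-1` exactly on `s`. -/
noncomputable def signVec {ι : Type*} (s : Finset ι) (i : ι) : ℝ :=
  open Classical in if i ∈ s then -1 else 1

lemma signVec_eq {ι : Type*} (s : Finset ι) (i : ι) : signVec s i = 1 ∨ signVec s i = -1 := by
  unfold signVec
  split_ifs <;> simp

lemma signVec_filter {ι : Type*} [Fintype ι] {w : ι → ℝ} (hw : ∀ i, w i = 1 ∨ w i = -1) :
    signVec (Finset.univ.filter fun i => w i = -1) = w := by
  ext i
  rcases hw i with h | h <;> simp [signVec, h]
  norm_num

lemma signVec_mul_signVec_eq {ι : Type*} (s t : Finset ι) (i : ι) :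
    signVec s i * signVec t i = 1 ∨ signVec s i * signVec t i = -1 := by
  rcases signVec_eq s i with h | h <;> rcases signVec_eq t i with h' | h' <;> simp [h, h']

lemma signVec_ne_signVec_mul_signVec {ι : Type*} (s t : Finset ι) (i : ι) :
    signVec s i ≠ signVec s i * signVec t i ↔ i ∈ t := by
  unfold signVec
  split_ifs <;> simp_all <;> norm_num

lemma mul_signVec_filter {ι : Type*} [Fintype ι] {w₁ w₂ : ι → ℝ}
    (hw₁ : ∀ i, w₁ i = 1 ∨ w₁ i = -1) (hw₂ : ∀ i, w₂ i = 1 ∨ w₂ i = -1) (i : ι) :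
    w₁ i * signVec (Finset.univ.filter fun i => w₁ i ≠ w₂ i) i = w₂ i := by
  rcases hw₁ i with h | h <;> rcases hw₂ i with h' | h' <;> simp [signVec, h, h']

/-- The first-moment bound: the expected number of solution pairs at distance `d`. -/
lemma measure_exists_pair_le (M N d : ℕ) (v : ℝ≥0) (K : ℝ) :
    (Measure.pi fun _ : Fin M × Fin N => gaussianReal 0 v)
        {ξ : Fin M × Fin N → ℝ | ∃ w₁ w₂ : Fin N → ℝ, (∀ i, w₁ i = 1 ∨ w₁ i = -1) ∧
          (∀ i, w₂ i = 1 ∨ w₂ i = -1) ∧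
          (Finset.univ.filter (fun i => w₁ i ≠ w₂ i)).card = d ∧
          ∀ μ : Fin M, |∑ i, ξ (μ, i) * w₁ i| ≤ K ∧ |∑ i, ξ (μ, i) * w₂ i| ≤ K} ≤
      2 ^ N * (N.choose d : ENNReal) * pairProb ((N - d : ℕ) * v) (d * v) K ^ M := by
  set P := (Finset.univ : Finset (Finset (Fin N))) ×ˢ
    Finset.powersetCard d (Finset.univ : Finset (Fin N))
  set E : Finset (Fin N) × Finset (Fin N) → Set (Fin M × Fin N → ℝ) := fun p =>
    {ξ | ∀ μ : Fin M, (fun i => ξ (μ, i)) ∈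
      {η : Fin N → ℝ | |∑ i, η i * signVec p.1 i| ≤ K ∧
        |∑ i, η i * (signVec p.1 i * signVec p.2 i)| ≤ K}}
  have hE : ∀ p ∈ P, (Measure.pi fun _ : Fin M × Fin N => gaussianReal 0 v) (E p) =
      pairProb ((N - d : ℕ) * v) (d * v) K ^ M := by
    intro p hp
    have hcard : p.2.card = d := (Finset.mem_powersetCard.1 (Finset.mem_product.1 hp).2).2
    rw [pi_prod_apply_forall,
      pi_gaussianReal_pair v (signVec_eq p.1) (signVec_mul_signVec_eq p.1 p.2), Fintype.card_fin]
    simp only [signVec_ne_signVec_mul_signVec, Finset.filter_univ_mem, hcard]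
    rw [Finset.filter_not, Finset.filter_univ_mem, ← Finset.compl_eq_univ_sdiff,
      Finset.card_compl, Fintype.card_fin, hcard]
  calc _ ≤ (Measure.pi fun _ : Fin M × Fin N => gaussianReal 0 v) (⋃ p ∈ P, E p) := by
        refine measure_mono ?_
        rintro ξ ⟨w₁, w₂, hw₁, hw₂, hd, hξ⟩
        refine Set.mem_biUnion (x := (Finset.univ.filter fun i => w₁ i = -1,
          Finset.univ.filter fun i => w₁ i ≠ w₂ i)) ?_ ?_
        · simp [P, Finset.mem_powersetCard, hd]
        · intro μ
          simp only [Set.mem_ofPred_eq, signVec_filter hw₁, mul_signVec_filter hw₁ hw₂]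
          exact hξ μ
    _ ≤ ∑ p ∈ P, (Measure.pi fun _ : Fin M × Fin N => gaussianReal 0 v) (E p) :=
        measure_biUnion_finset_le _ _
    _ = _ := by
        rw [Finset.sum_congr rfl hE, Finset.sum_const, nsmul_eq_mul]
        simp [P, Finset.card_product]

lemma choose_le_exp_entropy {x : ℝ} (hx : x ∈ Set.Ioo (0 : ℝ) 1) (N : ℕ) :
    (N.choose ⌊(N : ℝ) * x⌋₊ : ℝ) ≤ Real.exp (N * H₂ x - Real.log (1 - x)) := by
  set d := ⌊(N : ℝ) * x⌋₊
  have h0 : 0 < x := hx.1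
  have h1 : 0 < 1 - x := sub_pos.2 hx.2
  have hNx : (N : ℝ) * x ≤ N := mul_le_of_le_one_right (by positivity) hx.2.le
  have hd : (d : ℝ) ≤ N * x := Nat.floor_le (by positivity)
  have hd' : (N : ℝ) * x < d + 1 := Nat.lt_floor_add_one _
  have hdN : d ≤ N := by exact_mod_cast hd.trans hNx
  have hbin : x ^ d * (1 - x) ^ (N - d) * (N.choose d : ℝ) ≤ 1 := by
    calc x ^ d * (1 - x) ^ (N - d) * (N.choose d : ℝ)
        ≤ ∑ m ∈ Finset.range (N + 1), x ^ m * (1 - x) ^ (N - m) * (N.choose m : ℝ) :=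
          Finset.single_le_sum
            (f := fun m => x ^ m * (1 - x) ^ (N - m) * (N.choose m : ℝ))
            (fun m _ => by positivity) (Finset.mem_range.2 (by omega))
      _ = 1 := by rw [← add_pow]; simp
  have hexp : x ^ d * (1 - x) ^ (N - d) =
      Real.exp (d * Real.log x + (N - d) * Real.log (1 - x)) := by
    rw [Real.exp_add, ← Nat.cast_sub hdN, Real.exp_nat_mul, Real.exp_nat_mul, Real.exp_log h0,
      Real.exp_log h1]
  rw [hexp, mul_comm, ← le_div_iff₀ (Real.exp_pos _), one_div, ← Real.exp_neg] at hbin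
  refine hbin.trans (Real.exp_le_exp.2 ?_)
  have hl0 : Real.log x ≤ 0 := Real.log_nonpos h0.le hx.2.le
  have hl1 : Real.log (1 - x) ≤ 0 := Real.log_nonpos h1.le (by linarith)
  unfold H₂
  nlinarith [mul_nonneg (sub_nonneg.2 hd) (neg_nonneg.2 hl0),
    mul_nonneg (sub_nonneg.2 hd'.le) (neg_nonneg.2 hl1)]

/-- **First-moment upper bound for SAT-x-pairs.** Fix `K > 0`, `x ∈ (0,1)` and
`α > -(ln 2 + H₂(x))/ln f₁(x,K)`.  Then the probability (under patterns `ξ^μ`,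
`μ = 1,…,⌊αN⌋`, with i.i.d. `N(0,1/N)` entries) that there exists a pair
`w¹, w² ∈ {-1,1}^N` at Hamming distance `⌊Nx⌋` with `|ξ^μ · w^a| ≤ K` for all
`μ` and `a = 1,2`, tends to `0` as `N → ∞`. -/
theorem first_moment_upper_bound_pairs (K x α : ℝ) (hK : 0 < K)
    (hx : x ∈ Set.Ioo (0:ℝ) 1)
    (hα : α > -(Real.log 2 + H₂ x) / Real.log (f₁ x K)) :
    Filter.Tendsto
      (fun N : ℕ =>
        ((Measure.pi fun _ : Fin ⌊α * N⌋₊ × Fin N => gaussianReal 0 (1 / N : ℝ≥0))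
          {ξ : Fin ⌊α * N⌋₊ × Fin N → ℝ |
            ∃ w₁ w₂ : Fin N → ℝ, (∀ i, w₁ i = 1 ∨ w₁ i = -1) ∧
              (∀ i, w₂ i = 1 ∨ w₂ i = -1) ∧
              (Finset.univ.filter (fun i => w₁ i ≠ w₂ i)).card = ⌊(N : ℝ) * x⌋₊ ∧
              ∀ μ : Fin ⌊α * N⌋₊,
                |∑ i, ξ (μ, i) * w₁ i| ≤ K ∧ |∑ i, ξ (μ, i) * w₂ i| ≤ K}).toReal)
      Filter.atTop (nhds 0) := by
  have h1 : 0 < 1 - x := sub_pos.2 hx.2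
  have hf0 := f₁_pos hx hK
  have hlogf : Real.log (f₁ x K) < 0 := Real.log_neg hf0 (f₁_lt_one hx hK)
  have hrate : Real.log 2 + H₂ x + α * Real.log (f₁ x K) < 0 := by
    have := (div_lt_iff_of_neg hlogf).1 hα
    linarith
  set y : ℕ → ℝ := fun N => (⌊(N : ℝ) * x⌋₊ : ℝ) / N
  have hy : Filter.Tendsto y Filter.atTop (nhds x) := by
    have h := (tendsto_nat_floor_mul_div_atTop hx.1.le).comp
      (tendsto_natCast_atTop_atTop (R := ℝ))
    simpa only [Function.comp_def, mul_comm x] using h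
  have hy_mem : ∀ᶠ N in Filter.atTop, y N ∈ Set.Ioo (0 : ℝ) 1 :=
    hy.eventually (isOpen_Ioo.mem_nhds hx)
  have hf : Filter.Tendsto (fun N => f₁ (y N) K) Filter.atTop (nhds (f₁ x K)) :=
    ((continuousOn_f₁ K).continuousAt (isOpen_Ioo.mem_nhds hx)).tendsto.comp hy
  have hlog : Filter.Tendsto (fun N => Real.log (f₁ (y N) K)) Filter.atTop
      (nhds (Real.log (f₁ x K))) := hf.log hf0.ne'
  have hexponent : Filter.Tendsto
      (fun N : ℕ => (N : ℝ) * (Real.log 2 + H₂ x + α * Real.log (f₁ (y N) K)) +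
        (-Real.log (1 - x) - Real.log (f₁ (y N) K))) Filter.atTop Filter.atBot :=
    (tendsto_natCast_atTop_atTop.atTop_mul_neg hrate
      (tendsto_const_nhds.add (hlog.const_mul α))).atBot_add (tendsto_const_nhds.sub hlog)
  refine squeeze_zero' (Filter.Eventually.of_forall fun N => ENNReal.toReal_nonneg) ?_
    (Real.tendsto_exp_atBot.comp hexponent)
  filter_upwards [hy_mem, Filter.eventually_gt_atTop 0] with N hyN hN
  have hN0 : (0 : ℝ) < N := by exact_mod_cast hN
  set d := ⌊(N : ℝ) * x⌋₊
  have hdN : d ≤ N := by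
    have := (div_lt_one hN0).1 hyN.2
    exact_mod_cast this.le
  have hprob : pairProb ((N - d : ℕ) * (1 / N : ℝ≥0)) (d * (1 / N : ℝ≥0)) K =
      ENNReal.ofReal (f₁ (y N) K) := by
    refine pairProb_eq_f₁ hyN hK ?_ ?_
    · rw [NNReal.coe_mul, NNReal.coe_natCast, Nat.cast_sub hdN]
      push_cast
      simp only [y]
      field_simp
      rfl
    · push_cast
      simp only [y]
      field_simp
      rfl
  have hfN0 := f₁_pos hyN hK
  have hlogN : Real.log (f₁ (y N) K) < 0 := Real.log_neg hfN0 (f₁_lt_one hyN hK)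
  have hle := measure_exists_pair_le ⌊α * N⌋₊ N d (1 / N : ℝ≥0) K
  rw [hprob] at hle
  refine (ENNReal.toReal_mono (by finiteness) hle).trans ?_
  have hfloor : α * N < ⌊α * N⌋₊ + 1 := Nat.lt_floor_add_one _
  simp only [ENNReal.toReal_mul, ENNReal.toReal_pow, ENNReal.toReal_ofNat, ENNReal.toReal_natCast,
    ENNReal.toReal_ofReal hfN0.le, Function.comp_apply]
  calc (2 : ℝ) ^ N * (N.choose d : ℝ) * f₁ (y N) K ^ ⌊α * N⌋₊
      ≤ Real.exp (N * Real.log 2) * Real.exp (N * H₂ x - Real.log (1 - x)) *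
          Real.exp (⌊α * N⌋₊ * Real.log (f₁ (y N) K)) := by
        rw [Real.exp_nat_mul, Real.exp_log two_pos, Real.exp_nat_mul, Real.exp_log hfN0]
        gcongr
        exact choose_le_exp_entropy hx N
    _ ≤ _ := by
        rw [← Real.exp_add, ← Real.exp_add]
        refine Real.exp_le_exp.2 ?_
        nlinarith [mul_nonneg (sub_nonneg.2 hfloor.le) (neg_nonneg.2 hlogN.le)]
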